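/- Let G be a connected simple graph and let i, j, h, f be four distinct vertices of G such that i is adjacent to j, i is adjacent to h, j is adjacent to f, i is not adjacent to f, and j is not adjacent to h. Then the graph G' obtained from G by deleting the edges {i,h} and {j,f} and adding the edges {i,f} and {j,h} is connected. -/

import Mathlib

open SimpleGraph

/-- If the endpoints of every edge of a connected graph `G` are joined by a path in `G'`,
then `G'` is connected. -/
theorem SimpleGraph.Connected.of_adj_reachable {V : Type*} {G G' : SimpleGraph V}
    (hG : G.Connected) (h : ∀ u v, G.Adj u v → G'.Reachable u v) : G'.Connected := by
  have := hG.nonempty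
  refine ⟨fun u v => ?_⟩
  obtain ⟨p⟩ := hG.preconnected u v
  induction p with
  | nil => exact Reachable.refl _
  | cons huv _ ih => exact (h _ _ huv).trans ih

/-- **Rule r2 (neighbor swap) preserves connectivity.** If `G` is a connected simple
graph, `i ~ j`, `i ~ h`, `j ~ f`, `¬ i ~ f`, `¬ j ~ h`, and `i, j, h, f` are distinct,
then the graph obtained by deleting the edges `{i,h}` and `{j,f}` and adding the edges
`{i,f}` and `{j,h}` is connected. -/
theorem r2_preserves_connected {V : Type*} (G : SimpleGraph V) (hG : G.Connected)
    (i j h f : V)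
    (hij : i ≠ j) (hih : i ≠ h) (hif : i ≠ f) (hjh : j ≠ h) (hjf : j ≠ f) (hhf : h ≠ f)
    (aij : G.Adj i j) (aih : G.Adj i h) (ajf : G.Adj j f)
    (naif : ¬ G.Adj i f) (najh : ¬ G.Adj j h) :
    (G.deleteEdges {s(i, h), s(j, f)} ⊔
      SimpleGraph.fromEdgeSet {s(i, f), s(j, h)}).Connected := by
  set G' := G.deleteEdges {s(i, h), s(j, f)} ⊔ SimpleGraph.fromEdgeSet {s(i, f), s(j, h)}
  have adj_ij : G'.Adj i j := by
    simp [G', aij, hij, hij.symm, hjh, hif]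
  have adj_if : G'.Adj i f := by
    simp [G', hif]
  have adj_jh : G'.Adj j h := by
    simp [G', hjh]
  have reach_ih : G'.Reachable i h := adj_ij.reachable.trans adj_jh.reachable
  have reach_jf : G'.Reachable j f := adj_ij.symm.reachable.trans adj_if.reachable
  refine hG.of_adj_reachable fun u v huv => ?_
  by_cases huv' : s(u, v) ∈ ({s(i, h), s(j, f)} : Set (Sym2 V))
  · simp only [Set.mem_insert_iff, Set.mem_singleton_iff, Sym2.eq_iff] at huv'
    rcases huv' with (⟨rfl, rfl⟩ | ⟨rfl, rfl⟩) | (⟨rfl, rfl⟩ | ⟨rfl, rfl⟩)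
    exacts [reach_ih, reach_ih.symm, reach_jf, reach_jf.symm]
  · exact Adj.reachable (Or.inl (deleteEdges_adj.2 ⟨huv, huv'⟩))
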